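/- arXiv:1401.5354 — 2 statements merged into one kernel-verified Lean document; each statement's English description precedes it below -/
import Mathlib

section
/- Let m be a positive integer and consider a house allocation instance with m applicants. Then the set E* of all houses b such that some Pareto optimal matching contains b in its image satisfies |E*| ≤ Σ_{i=1}^{m} floor(m/i), and hence |E*| ≤ m(ln m + 1). -/
/-- `S` is a blocking coalition of the matching `τ`. -/
def IsBlocking {A B : Type*} (pref : A → B → B → Prop) (τ : A → B) (S : Set A) : Prop :=
  S.Nonempty ∧ ∃ τ' : A → B, Function.Injective τ' ∧
    (∀ a ∉ S, τ' a = τ a) ∧ ∀ a ∈ S, pref a (τ' a) (τ a)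

/-- `τ` is a Pareto optimal matching. -/
def IsPOM {A B : Type*} (pref : A → B → B → Prop) (τ : A → B) : Prop :=
  Function.Injective τ ∧ ∀ S : Set A, ¬ IsBlocking pref τ S

/-- In a Pareto optimal matching, every house an applicant prefers to its own is taken. -/
theorem IsPOM.mem_range_of_pref {A B : Type*} {pref : A → B → B → Prop} {τ : A → B}
    (hτ : IsPOM pref τ) {a : A} {b : B} (h : pref a b (τ a)) : b ∈ Set.range τ := by
  classical
  by_contra hb
  refine hτ.2 {a} ⟨Set.singleton_nonempty a, Function.update τ a b, ?_, ?_, ?_⟩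
  · intro x y hxy
    by_cases hx : x = a <;> by_cases hy : y = a
    · rw [hx, hy]
    · subst hx
      rw [Function.update_self, Function.update_of_ne hy] at hxy
      exact absurd ⟨y, hxy.symm⟩ hb
    · subst hy
      rw [Function.update_self, Function.update_of_ne hx] at hxy
      exact absurd ⟨x, hxy⟩ hb
    · rw [Function.update_of_ne hx, Function.update_of_ne hy] at hxy
      exact hτ.1 hxy
  · intro x hx
    exact Function.update_of_ne hx _ _
  · rintro x rfl
    simpa using h

/-- Two Pareto optimal matchings cannot both give an applicant a house unused by the other. -/
theorem IsPOM.mem_range_or_mem_range {A B : Type*} {pref : A → B → B → Prop}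
    (hpref : ∀ a, IsStrictTotalOrder B (pref a)) {τ σ : A → B}
    (hτ : IsPOM pref τ) (hσ : IsPOM pref σ) (a : A) :
    τ a ∈ Set.range σ ∨ σ a ∈ Set.range τ := by
  have := hpref a
  rcases trichotomous_of (pref a) (τ a) (σ a) with h | h | h
  · exact Or.inl (hσ.mem_range_of_pref h)
  · exact Or.inl ⟨a, h.symm⟩
  · exact Or.inr (hτ.mem_range_of_pref h)

open Finset in
/-- The applicants who, under one member `τ` of a family of Pareto optimal matchings, get a house
used by no other member form disjoint sets, so that some member has few private houses. -/
theorem exists_card_private_le {A B : Type*} [Fintype A] [DecidableEq A] [DecidableEq B]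
    {pref : A → B → B → Prop} (hpref : ∀ a, IsStrictTotalOrder B (pref a))
    (T : Finset (A → B)) (hT : ∀ τ ∈ T, IsPOM pref τ) (hne : T.Nonempty) :
    ∃ τ ∈ T, #{a | τ a ∉ (T.erase τ).biUnion fun σ => univ.image σ} ≤
      Fintype.card A / #T := by
  by_contra! hcon
  set N : (A → B) → Finset A :=
    fun τ => {a | τ a ∉ (T.erase τ).biUnion fun σ => univ.image σ} with hN
  have hdisj : (T : Set (A → B)).PairwiseDisjoint N := by
    intro τ hτ σ hσ hne
    refine disjoint_left.2 fun a haτ haσ => ?_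
    simp only [hN, mem_filter, mem_univ, true_and, mem_biUnion, mem_erase, mem_image,
      not_exists, not_and] at haτ haσ
    rcases (hT τ hτ).mem_range_or_mem_range hpref (hT σ hσ) a with ⟨c, hc⟩ | ⟨c, hc⟩
    · exact haτ σ ⟨hne.symm, hσ⟩ c hc
    · exact haσ τ ⟨hne, hτ⟩ c hc
  have hle : ∑ τ ∈ T, #(N τ) ≤ Fintype.card A := by
    rw [← card_biUnion hdisj]
    exact card_le_univ _
  have hge : #T * (Fintype.card A / #T + 1) ≤ ∑ τ ∈ T, #(N τ) := by
    rw [← smul_eq_mul]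
    exact card_nsmul_le_sum _ _ _ fun τ hτ => hcon τ hτ
  have := Nat.lt_mul_div_succ (Fintype.card A) hne.card_pos
  omega

open Finset in
/-- A family of Pareto optimal matchings uses at most `∑ i ≤ #T, ⌊m / i⌋` houses altogether. -/
theorem card_biUnion_image_le {A B : Type*} [Fintype A] [DecidableEq A] [DecidableEq B]
    {pref : A → B → B → Prop} (hpref : ∀ a, IsStrictTotalOrder B (pref a))
    (T : Finset (A → B)) (hT : ∀ τ ∈ T, IsPOM pref τ) :
    #(T.biUnion fun τ => univ.image τ) ≤ ∑ i ∈ Icc 1 #T, Fintype.card A / i := by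
  induction hn : #T generalizing T with
  | zero => simp [card_eq_zero.1 hn]
  | succ n ih =>
    obtain ⟨τ, hτ, hle⟩ := exists_card_private_le hpref T hT (card_pos.1 (by omega))
    have hsub : (T.biUnion fun τ => univ.image τ) ⊆
        ((T.erase τ).biUnion fun σ => univ.image σ) ∪
          ({a | τ a ∉ (T.erase τ).biUnion fun σ => univ.image σ} : Finset A).image τ := by
      intro b hb
      by_cases hb' : b ∈ (T.erase τ).biUnion fun σ => univ.image σ
      · exact mem_union_left _ hb'
      · refine mem_union_right _ ?_
        obtain ⟨σ, hσ, hbσ⟩ := mem_biUnion.1 hb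
        have hστ : σ = τ := by
          by_contra hne
          exact hb' (mem_biUnion.2 ⟨σ, mem_erase.2 ⟨hne, hσ⟩, hbσ⟩)
        subst hστ
        obtain ⟨a, -, rfl⟩ := mem_image.1 hbσ
        exact mem_image_of_mem _ (mem_filter.2 ⟨mem_univ _, hb'⟩)
    have hrec := ih (T.erase τ) (fun σ hσ => hT σ (mem_of_mem_erase hσ))
      (by rw [card_erase_of_mem hτ, hn, Nat.add_sub_cancel])
    rw [hn] at hle
    rw [sum_Icc_succ_top (by omega)]
    exact (card_le_card hsub).trans
      ((card_union_le _ _).trans (add_le_add hrec (card_image_le.trans hle)))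

/-- Terms of `∑ ⌊m / i⌋` beyond `i = m` vanish. -/
theorem sum_Icc_div_le (m t : ℕ) :
    ∑ i ∈ Finset.Icc 1 t, m / i ≤ ∑ i ∈ Finset.Icc 1 m, m / i := by
  refine Finset.sum_le_sum_of_ne_zero fun i hi hne => ?_
  rw [Finset.mem_Icc] at hi ⊢
  refine ⟨hi.1, ?_⟩
  by_contra h
  exact hne (Nat.div_eq_of_lt (by omega))

theorem sum_Icc_div_le_mul_log (m : ℕ) :
    ((∑ i ∈ Finset.Icc 1 m, m / i : ℕ) : ℝ) ≤ m * (Real.log m + 1) := by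
  calc ((∑ i ∈ Finset.Icc 1 m, m / i : ℕ) : ℝ)
      ≤ ∑ i ∈ Finset.Icc 1 m, (m : ℝ) * (i : ℝ)⁻¹ := by
        push_cast
        exact Finset.sum_le_sum fun i _ => by
          rw [← div_eq_mul_inv]
          exact Nat.cast_div_le
    _ = m * (harmonic m : ℝ) := by
        rw [harmonic_eq_sum_Icc]
        push_cast
        rw [Finset.mul_sum]
    _ ≤ m * (Real.log m + 1) := by
        rw [add_comm]
        gcongr
        exact harmonic_le_one_add_log m

/-- the set `E*` of reachable houses of an instance with `m`
applicants satisfies `|E*| ≤ ∑_{i=1}^m ⌊m/i⌋` and hence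
`|E*| ≤ m (ln m + 1)`. -/
theorem stmt6 {A B : Type*} [Fintype A] [Fintype B] (m : ℕ)
    (hm : Fintype.card A = m) (hmpos : 0 < m)
    (pref : A → B → B → Prop) (hpref : ∀ a, IsStrictTotalOrder B (pref a)) :
    {b : B | ∃ τ : A → B, IsPOM pref τ ∧ b ∈ Set.range τ}.ncard ≤
        ∑ i ∈ Finset.Icc 1 m, m / i ∧
      (({b : B | ∃ τ : A → B, IsPOM pref τ ∧ b ∈ Set.range τ}.ncard : ℝ) ≤
        m * (Real.log m + 1)) := by
  classical
  have hcard : {b : B | ∃ τ : A → B, IsPOM pref τ ∧ b ∈ Set.range τ}.ncard ≤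
      ∑ i ∈ Finset.Icc 1 m, m / i := by
    have hset : {b : B | ∃ τ : A → B, IsPOM pref τ ∧ b ∈ Set.range τ} =
        ((Finset.univ.filter (IsPOM pref)).biUnion fun τ : A → B => Finset.univ.image τ :
          Finset B) := by
      ext b
      simp
    rw [hset, Set.ncard_coe_finset]
    refine (card_biUnion_image_le hpref _ fun τ hτ => (Finset.mem_filter.1 hτ).2).trans ?_
    rw [hm]
    exact sum_Icc_div_le m _
  exact ⟨hcard, (Nat.cast_le.2 hcard).trans (sum_Icc_div_le_mul_log m)⟩
end

section
/- For a house allocation instance with m applicants, the number of subsets E ⊆ B with |E| = m that arise as the image of some Pareto optimal matching is at most the binomial coefficient C(⌈m(ln m + 1)⌉, m). More precisely, it is at most C(|E*|, m) where E* is the set of reachable houses, and |E*| ≤ m(ln m + 1). -/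
theorem Finset.sum_inv_card_filter_le_harmonic {ι α : Type*} [LinearOrder α] (g : ι → α)
    (s : Finset ι) :
    ∑ j ∈ s, ((s.filter fun k => g j ≤ g k).card : ℚ)⁻¹ ≤ harmonic s.card := by
  classical
  induction s using Finset.induction_on_min_value g with
  | empty => simp
  | insert a s ha hmin ih =>
    rw [Finset.sum_insert ha, Finset.card_insert_of_notMem ha, harmonic_succ, add_comm]
    refine add_le_add ((Finset.sum_le_sum fun j hj => ?_).trans ih) (le_of_eq ?_)
    · have hpos : 0 < (s.filter fun k => g j ≤ g k).card :=
        Finset.card_pos.2 ⟨j, by simp [hj]⟩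
      have hle := Finset.card_le_card
        (Finset.filter_subset_filter (fun k => g j ≤ g k) (Finset.subset_insert a s))
      gcongr
    · rw [Finset.filter_true_of_mem, Finset.card_insert_of_notMem ha]
      simpa using hmin

/-- The images of a family of `n` Pareto optimal matchings of `m` applicants cover at most
`m * harmonic n` houses. -/
theorem card_biUnion_image_le_mul_harmonic {A B ι : Type*} [Fintype A] [Fintype ι]
    [DecidableEq B] {pref : A → B → B → Prop} (hpref : ∀ a, IsStrictTotalOrder B (pref a))
    {τ : ι → A → B} (hτ : ∀ j, IsPOM pref (τ j)) :
    ((Finset.univ.biUnion fun j => Finset.univ.image (τ j)).card : ℚ) ≤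
      Fintype.card A * harmonic (Fintype.card ι) := by
  classical
  set U := Finset.univ.biUnion fun j => Finset.univ.image (τ j) with hU
  let mult : B → Finset ι := fun b => Finset.univ.filter fun j => b ∈ Set.range (τ j)
  have hcount : (U.card : ℚ) = ∑ a, ∑ j, ((mult (τ j a)).card : ℚ)⁻¹ := by
    have hone : ∀ b ∈ U, ∑ j ∈ mult b, ((mult b).card : ℚ)⁻¹ = 1 := by
      intro b hb
      obtain ⟨j, -, hj⟩ := Finset.mem_biUnion.1 hb
      have hne : ((mult b).card : ℚ) ≠ 0 := by
        rw [Nat.cast_ne_zero, Finset.card_ne_zero]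
        exact ⟨j, by simpa [mult] using hj⟩
      rw [Finset.sum_const, nsmul_eq_mul, mul_inv_cancel₀ hne]
    calc (U.card : ℚ) = ∑ b ∈ U, ∑ j ∈ mult b, ((mult b).card : ℚ)⁻¹ := by
          rw [Finset.sum_congr rfl hone]; simp
      _ = ∑ j, ∑ b ∈ Finset.univ.image (τ j), ((mult b).card : ℚ)⁻¹ := by
          refine Finset.sum_comm' fun b j => ?_
          simp only [hU, mult, Finset.mem_biUnion, Finset.mem_filter, Finset.mem_image,
            Finset.mem_univ, true_and, and_true, Set.mem_range]
          exact ⟨fun h => h.2, fun h => ⟨⟨j, h⟩, h⟩⟩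
      _ = ∑ j, ∑ a, ((mult (τ j a)).card : ℚ)⁻¹ :=
          Finset.sum_congr rfl fun j _ => Finset.sum_image fun _ _ _ _ h => (hτ j).1 h
      _ = _ := Finset.sum_comm
  have hrow : ∀ a, ∑ j, ((mult (τ j a)).card : ℚ)⁻¹ ≤ harmonic (Fintype.card ι) := by
    intro a
    have := hpref a
    let _ : LinearOrder B := linearOrderOfSTO (pref a)
    refine (Finset.sum_le_sum fun j _ => ?_).trans
      (Finset.sum_inv_card_filter_le_harmonic (fun j => τ j a) Finset.univ)
    have hpos : 0 < (Finset.univ.filter fun k => τ j a ≤ τ k a).card :=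
      Finset.card_pos.2 ⟨j, by simp⟩
    have hsub : (Finset.univ.filter fun k => τ j a ≤ τ k a) ⊆ mult (τ j a) := by
      intro k hk
      simp only [mult, Finset.mem_filter, Finset.mem_univ, true_and] at hk ⊢
      rcases hk.eq_or_lt with h | h
      · exact ⟨a, h.symm⟩
      · exact (hτ k).mem_range_of_pref h
    have hle := Finset.card_le_card hsub
    gcongr
  rw [hcount]
  refine (Finset.sum_le_sum fun a _ => hrow a).trans ?_
  simp

theorem exists_isPOM_family_covering {A B : Type*} [Finite B] {pref : A → B → B → Prop}
    (hpref : ∀ a, IsStrictTotalOrder B (pref a)) (hne : ∃ τ, IsPOM pref τ) :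
    ∃ σ : A → A → B, (∀ a, IsPOM pref (σ a)) ∧
      ∀ τ, IsPOM pref τ → ∀ a, τ a ∈ Set.range (σ a) := by
  classical
  have hworst : ∀ a, ∃ σ, IsPOM pref σ ∧ ∀ τ, IsPOM pref τ → τ a ∈ Set.range σ := by
    intro a
    have := hpref a
    let _ : LinearOrder B := linearOrderOfSTO (pref a)
    obtain ⟨τ₀, hτ₀⟩ := hne
    obtain ⟨b, ⟨σ, hσ, rfl⟩, hmax⟩ := Set.exists_max_image {b | ∃ τ, IsPOM pref τ ∧ τ a = b} id
      (Set.toFinite _) ⟨τ₀ a, τ₀, hτ₀, rfl⟩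
    refine ⟨σ, hσ, fun τ hτ => ?_⟩
    have hle : τ a ≤ σ a := hmax _ ⟨τ, hτ, rfl⟩
    rcases hle.eq_or_lt with h | h
    · exact ⟨a, h.symm⟩
    · exact hσ.mem_range_of_pref h
  choose σ hσ using hworst
  exact ⟨σ, fun a => (hσ a).1, fun τ hτ a => (hσ a).2 τ hτ⟩

theorem ncard_reachable_le {A B : Type*} [Fintype A] [Finite B] {pref : A → B → B → Prop}
    (hpref : ∀ a, IsStrictTotalOrder B (pref a)) :
    ({b : B | ∃ τ : A → B, IsPOM pref τ ∧ b ∈ Set.range τ}.ncard : ℚ) ≤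
      Fintype.card A * harmonic (Fintype.card A) := by
  classical
  by_cases hne : ∃ τ, IsPOM pref τ
  · obtain ⟨σ, hσ, hcover⟩ := exists_isPOM_family_covering hpref hne
    refine le_trans ?_ (card_biUnion_image_le_mul_harmonic hpref hσ)
    rw [← Set.ncard_coe_finset]
    refine Nat.cast_le.2 (Set.ncard_le_ncard ?_ (Finset.finite_toSet _))
    rintro _ ⟨τ, hτ, a, rfl⟩
    simpa using ⟨a, hcover τ hτ a⟩
  · have hempty : {b : B | ∃ τ : A → B, IsPOM pref τ ∧ b ∈ Set.range τ} = ∅ :=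
      Set.eq_empty_of_forall_notMem fun b ⟨τ, hτ, _⟩ => hne ⟨τ, hτ⟩
    have hnonneg : 0 ≤ harmonic (Fintype.card A) :=
      Finset.sum_nonneg fun i _ => by positivity
    rw [hempty, Set.ncard_empty, Nat.cast_zero]
    positivity

/-- the number of exactly reachable `m`-element sets is at most
`C(⌈m(ln m + 1)⌉, m)`; more precisely it is at most `C(|E*|, m)` where `E*` is
the set of reachable houses, and `|E*| ≤ m(ln m + 1)`. -/
theorem stmt7 {A B : Type*} [Fintype A] [Fintype B] (m : ℕ)
    (hm : Fintype.card A = m) (hmpos : 0 < m)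
    (pref : A → B → B → Prop) (hpref : ∀ a, IsStrictTotalOrder B (pref a)) :
    {E : Finset B | E.card = m ∧
        ∃ τ : A → B, IsPOM pref τ ∧ Set.range τ = ↑E}.ncard ≤
        Nat.choose ⌈(m : ℝ) * (Real.log m + 1)⌉₊ m ∧
      {E : Finset B | E.card = m ∧
        ∃ τ : A → B, IsPOM pref τ ∧ Set.range τ = ↑E}.ncard ≤
        Nat.choose {b : B | ∃ τ : A → B, IsPOM pref τ ∧ b ∈ Set.range τ}.ncard m ∧
      (({b : B | ∃ τ : A → B, IsPOM pref τ ∧ b ∈ Set.range τ}.ncard : ℝ) ≤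
        m * (Real.log m + 1)) := by
  classical
  set R := {b : B | ∃ τ : A → B, IsPOM pref τ ∧ b ∈ Set.range τ} with hR
  have hlog : (R.ncard : ℝ) ≤ m * (Real.log m + 1) := by
    have h : ((R.ncard : ℚ) : ℝ) ≤ ((m * harmonic m : ℚ) : ℝ) :=
      Rat.cast_le.2 (hm ▸ ncard_reachable_le hpref)
    push_cast at h
    refine h.trans ?_
    rw [add_comm]
    gcongr
    exact harmonic_le_one_add_log m
  have hchoose : {E : Finset B | E.card = m ∧
      ∃ τ : A → B, IsPOM pref τ ∧ Set.range τ = ↑E}.ncard ≤ Nat.choose R.ncard m := by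
    rw [Set.ncard_eq_toFinset_card' R, ← Finset.card_powersetCard, ← Set.ncard_coe_finset]
    refine Set.ncard_le_ncard ?_ (Finset.finite_toSet _)
    rintro E ⟨hE, τ, hτ, hrange⟩
    rw [Finset.mem_coe, Finset.mem_powersetCard]
    refine ⟨fun b hb => ?_, hE⟩
    rw [Set.mem_toFinset]
    exact ⟨τ, hτ, hrange ▸ hb⟩
  refine ⟨hchoose.trans (Nat.choose_le_choose m ?_), hchoose, hlog⟩
  exact Nat.cast_le.1 (hlog.trans (Nat.le_ceil _))
end
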